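/- Let D be a graph database over Σ, let 𝔾₁ and 𝔾₂ be basic graph patterns, and let S be the largest dual simulation between G(𝔾₁ ∪ 𝔾₂) and D. Then for every μ ∈ ⟦𝔾₁ AND 𝔾₂⟧_D and every variable v ∈ dom(μ), it holds that (v, μ(v)) ∈ S. -/

import Mathlib

/-- A relation `S ⊆ V₁ × V₂` is a dual simulation between the edge-labeled directed
graphs `(V₁, E₁)` and `(V₂, E₂)` over the same label alphabet `L`. -/
def DualSim {V₁ V₂ L : Type*} (E₁ : Set (V₁ × L × V₁)) (E₂ : Set (V₂ × L × V₂))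
    (S : Set (V₁ × V₂)) : Prop :=
  ∀ v₁ v₂, (v₁, v₂) ∈ S →
    (∀ a w₁, (v₁, a, w₁) ∈ E₁ → ∃ w₂, (v₂, a, w₂) ∈ E₂ ∧ (w₁, w₂) ∈ S) ∧
    (∀ a u₁, (u₁, a, v₁) ∈ E₁ → ∃ u₂, (u₂, a, v₂) ∈ E₂ ∧ (u₁, u₂) ∈ S)

/-- The set of variables occurring in the triple patterns of a basic graph pattern. -/
def varsOf {𝒱 L : Type*} (G : Set (𝒱 × L × 𝒱)) : Set 𝒱 :=
  {v | ∃ a w, (v, a, w) ∈ G ∨ (w, a, v) ∈ G}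

/-- `μ` (a partial function, encoded via `Option`) is a match for the basic graph
pattern `G` in the graph database with edge relation `ED`: its domain is exactly
`varsOf G` and every triple pattern of `G` is realized as an edge of the database. -/
def IsMatch {𝒱 O L : Type*} (ED : Set (O × L × O)) (G : Set (𝒱 × L × 𝒱))
    (μ : 𝒱 → Option O) : Prop :=
  (∀ v, (∃ o, μ v = some o) ↔ v ∈ varsOf G) ∧
  ∀ v a w, (v, a, w) ∈ G → ∃ o o', μ v = some o ∧ μ w = some o' ∧ (o, a, o') ∈ ED

/-- The match `μ` viewed as a relation `{(v, μ(v)) | v ∈ dom(μ)}`. -/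
def matchRel {𝒱 O : Type*} (μ : 𝒱 → Option O) : Set (𝒱 × O) :=
  {p | μ p.1 = some p.2}

/-- Two partial functions are compatible iff they agree on their common domain. -/
def Compatible {𝒱 O : Type*} (μ₁ μ₂ : 𝒱 → Option O) : Prop :=
  ∀ v o₁ o₂, μ₁ v = some o₁ → μ₂ v = some o₂ → o₁ = o₂

/-- Union of two partial functions (left-biased; on compatible ones this is the union). -/
def munion {𝒱 O : Type*} (μ₁ μ₂ : 𝒱 → Option O) : 𝒱 → Option O :=
  fun v => (μ₁ v).orElse (fun _ => μ₂ v)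

/-- Restriction of a partial function to a set of variables. -/
noncomputable def restrictDom {𝒱 O : Type*} (μ : 𝒱 → Option O) (A : Set 𝒱) :
    𝒱 → Option O :=
  fun v => letI := Classical.dec (v ∈ A); if v ∈ A then μ v else none

/-- SPARQL conjunction (AND) semantics: compatible unions of matches. -/
def AndSem {𝒱 O L : Type*} (ED : Set (O × L × O)) (G₁ G₂ : Set (𝒱 × L × 𝒱)) :
    Set (𝒱 → Option O) :=
  {μ | ∃ μ₁ μ₂, IsMatch ED G₁ μ₁ ∧ IsMatch ED G₂ μ₂ ∧ Compatible μ₁ μ₂ ∧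
    μ = munion μ₁ μ₂}

/-- SPARQL optional (OPT) semantics: left-outer join. -/
def OptSem {𝒱 O L : Type*} (ED : Set (O × L × O)) (G₁ G₂ : Set (𝒱 × L × 𝒱)) :
    Set (𝒱 → Option O) :=
  AndSem ED G₁ G₂ ∪
    {μ | IsMatch ED G₁ μ ∧ ∀ μ', IsMatch ED G₂ μ' → ¬ Compatible μ μ'}

theorem munion_eq_some_left {𝒱 O : Type*} {μ₁ μ₂ : 𝒱 → Option O} {v : 𝒱} {o : O}
    (h : μ₁ v = some o) : munion μ₁ μ₂ v = some o := by
  simp [munion, h]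

theorem Compatible.munion_eq_some_right {𝒱 O : Type*} {μ₁ μ₂ : 𝒱 → Option O}
    (hc : Compatible μ₁ μ₂) {v : 𝒱} {o : O} (h : μ₂ v = some o) :
    munion μ₁ μ₂ v = some o := by
  cases h' : μ₁ v with
  | none => simp [munion, h, h']
  | some o' => simp [munion, h', hc v o' o h' h]

/-- If every triple pattern of `G` is realized by `μ`, then `μ`, viewed as a relation,
is a dual simulation. -/
theorem dualSim_matchRel {𝒱 O L : Type*} {ED : Set (O × L × O)} {G : Set (𝒱 × L × 𝒱)}
    {μ : 𝒱 → Option O}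
    (h : ∀ v a w, (v, a, w) ∈ G →
      ∃ o o', μ v = some o ∧ μ w = some o' ∧ (o, a, o') ∈ ED) :
    DualSim G ED (matchRel μ) := by
  intro v o hv
  change μ v = some o at hv
  refine ⟨fun a w hG => ?_, fun a u hG => ?_⟩
  · obtain ⟨p, q, hp, hq, hE⟩ := h _ _ _ hG
    obtain rfl : o = p := Option.some.inj (hv.symm.trans hp)
    exact ⟨q, hE, hq⟩
  · obtain ⟨p, q, hp, hq, hE⟩ := h _ _ _ hG
    obtain rfl : o = q := Option.some.inj (hv.symm.trans hq)
    exact ⟨p, hE, hp⟩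

/-- Soundness of the combined SOI for conjunctions: every assignment made by a match
of `𝔾₁ AND 𝔾₂` is contained in the largest dual simulation between `G(𝔾₁ ∪ 𝔾₂)`
and the database. -/
theorem andSem_soundness {𝒱 O L : Type*} (ED : Set (O × L × O))
    (G₁ G₂ : Set (𝒱 × L × 𝒱)) (h₁ : G₁.Finite) (h₂ : G₂.Finite)
    (S : Set (𝒱 × O)) (hS : DualSim (G₁ ∪ G₂) ED S)
    (hmax : ∀ S', DualSim (G₁ ∪ G₂) ED S' → S' ⊆ S)
    (μ : 𝒱 → Option O) (hμ : μ ∈ AndSem ED G₁ G₂)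
    (v : 𝒱) (o : O) (ho : μ v = some o) :
    (v, o) ∈ S := by
  obtain ⟨μ₁, μ₂, hm₁, hm₂, hc, rfl⟩ := hμ
  refine hmax (matchRel (munion μ₁ μ₂)) (dualSim_matchRel ?_) ho
  rintro x a y (hG | hG)
  · obtain ⟨p, q, hp, hq, hE⟩ := hm₁.2 _ _ _ hG
    exact ⟨p, q, munion_eq_some_left hp, munion_eq_some_left hq, hE⟩
  · obtain ⟨p, q, hp, hq, hE⟩ := hm₂.2 _ _ _ hG
    exact ⟨p, q, hc.munion_eq_some_right hp, hc.munion_eq_some_right hq, hE⟩
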